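/- Let s and t be bounded transfinite sequences of reals of the same nonzero length whose means 𝕄(s) and 𝕄(t) exist, and let a, b ∈ ℝ. Then the mean of the pointwise combination a·s + b·t exists and 𝕄(a·s + b·t) = a·𝕄(s) + b·𝕄(t). -/

import Mathlib

open Ordinal

/-- The number `n` of full blocks in the standard decomposition `o = ω^σ·n + ρ`,
where `ω^σ = ω ^ log ω o` is the largest indecomposable ordinal `≤ o`. -/
noncomputable def stdBlocks (o : Ordinal.{0}) : ℕ :=
  Cardinal.toNat (o / omega0 ^ log omega0 o).card

/-- The upper mean `M̄` of a transfinite sequence of reals.  A sequence of length `o`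
is encoded as a total function `f : Ordinal → ℝ`; only the values of `f` at ordinals
`< o` are ever used.  It is defined by transfinite recursion on `o`:
(1) for `o = 1` it is `f 0`;
(2) for `o` indecomposable with `o > 1` (i.e. `o = ω^σ` with `σ > 0`) it is
    `limsup_{ξ → o} M̄(f|_ξ) = inf_{1 ≤ ζ < o} sup_{ζ ≤ ξ < o} M̄(f|_ξ)`;
(3) for decomposable `o`, writing `o = ω^σ·n + ρ` with `ρ < ω^σ`, it is the average
    `(1/n) (M̄(s₀) + ⋯ + M̄(s_{n-1}))` of the upper means of the `n` consecutive
    blocks of `f` of length `ω^σ` (the remainder of length `ρ` is discarded). -/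
noncomputable def upperMean (o : Ordinal.{0}) (f : Ordinal.{0} → ℝ) : ℝ :=
  if o = 1 then f 0
  else if h1 : 1 < o ∧ o = omega0 ^ log omega0 o then
    ⨅ ζ : Set.Ico (1 : Ordinal.{0}) o, ⨆ ξ : Set.Ico ζ.1 o, upperMean ξ.1 f
  else if h2 : 1 < o then
    ((stdBlocks o : ℝ))⁻¹ *
      ∑ i ∈ Finset.range (stdBlocks o),
        upperMean (omega0 ^ log omega0 o)
          (fun ξ => f (omega0 ^ log omega0 o * (i : Ordinal) + ξ))
  else 0
termination_by o
decreasing_by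
  · exact ξ.2.2
  · exact lt_of_le_of_ne (opow_log_le_self _ (zero_lt_one.trans h2).ne')
      fun h => h1 ⟨h2, h.symm⟩

/-- A transfinite sequence of reals of length `o` is bounded if its range
(on indices `< o`) is bounded in `ℝ`. -/
def SeqBounded (o : Ordinal.{0}) (f : Ordinal.{0} → ℝ) : Prop :=
  ∃ C : ℝ, ∀ ξ < o, |f ξ| ≤ C

/-- The concatenation `r ⊕ s` of a sequence `r` of length `a` with a sequence `s`:
its first `a` entries are those of `r`, and its entry at `a + ξ'` is `s ξ'`. -/
noncomputable def concatSeq (a : Ordinal.{0}) (r s : Ordinal.{0} → ℝ) :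
    Ordinal.{0} → ℝ :=
  fun ξ => if ξ < a then r ξ else s (ξ - a)

/-- An ordinal is indecomposable if it is nonzero and not the sum of two strictly
smaller ordinals. -/
def IsIndecomposable (o : Ordinal.{0}) : Prop :=
  o ≠ 0 ∧ ∀ b < o, ∀ c < o, b + c ≠ o

/-- The concatenation `s₀ ⊕ s₁ ⊕ ⋯ ⊕ s_{n-1}` of `n` sequences, each of length `β`;
the result has length `β * n`. -/
noncomputable def concatN (β : Ordinal.{0}) :
    (n : ℕ) → (Fin n → Ordinal.{0} → ℝ) → Ordinal.{0} → ℝ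
  | 0, _ => fun _ => 0
  | n + 1, s => concatSeq (β * n) (concatN β n (fun i => s i.castSucc)) (s (Fin.last n))

/-- `s / β`: given a sequence `s` whose length is `β * α`, the sequence of length `α`
whose `ι`-th entry is the upper mean of the `ι`-th consecutive block of `s` of
length `β`. -/
noncomputable def seqDiv (s : Ordinal.{0} → ℝ) (β : Ordinal.{0}) : Ordinal.{0} → ℝ :=
  fun ι => upperMean β (fun ξ => s (β * ι + ξ))

/-- The lower mean `𝕄̲(s) = -M̄(-s)`. -/
noncomputable def lowerMean (o : Ordinal.{0}) (s : Ordinal.{0} → ℝ) : ℝ :=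
  - upperMean o (fun ξ => - s ξ)

/-- A sequence `s` of length `o` has mean `c` when its upper and lower means both
equal `c`. -/
def HasMean (o : Ordinal.{0}) (s : Ordinal.{0} → ℝ) (c : ℝ) : Prop :=
  upperMean o s = c ∧ lowerMean o s = c

theorem upperMean_one (f : Ordinal.{0} → ℝ) : upperMean 1 f = f 0 := by
  rw [upperMean, if_pos rfl]

theorem upperMean_zero (f : Ordinal.{0} → ℝ) : upperMean 0 f = 0 := by
  rw [upperMean]
  simp

theorem upperMean_indecomposable {o : Ordinal.{0}} (h : 1 < o)
    (h' : o = omega0 ^ log omega0 o) (f : Ordinal.{0} → ℝ) :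
    upperMean o f = ⨅ ζ : Set.Ico (1 : Ordinal.{0}) o, ⨆ ξ : Set.Ico ζ.1 o, upperMean ξ.1 f := by
  rw [upperMean, if_neg h.ne', dif_pos ⟨h, h'⟩]

theorem upperMean_decomposable {o : Ordinal.{0}} (h : 1 < o)
    (h' : o ≠ omega0 ^ log omega0 o) (f : Ordinal.{0} → ℝ) :
    upperMean o f = ((stdBlocks o : ℝ))⁻¹ *
      ∑ i ∈ Finset.range (stdBlocks o),
        upperMean (omega0 ^ log omega0 o)
          (fun ξ => f (omega0 ^ log omega0 o * (i : Ordinal) + ξ)) := by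
  rw [upperMean, if_neg h.ne', dif_neg fun h'' => h' h''.2, dif_pos h]

theorem natCast_stdBlocks (o : Ordinal.{0}) :
    (stdBlocks o : Ordinal.{0}) = o / omega0 ^ log omega0 o := by
  obtain ⟨n, hn⟩ := lt_omega0.1 (div_opow_log_lt o one_lt_omega0)
  simp [stdBlocks, hn]

/-- The entries of each full block of a sequence of length `o` have index below `o`. -/
theorem block_index_lt {o ξ : Ordinal.{0}} {i : ℕ} (hi : i < stdBlocks o)
    (hξ : ξ < omega0 ^ log omega0 o) : omega0 ^ log omega0 o * (i : Ordinal) + ξ < o := by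
  calc omega0 ^ log omega0 o * (i : Ordinal) + ξ
      < omega0 ^ log omega0 o * (i : Ordinal) + omega0 ^ log omega0 o := by gcongr
    _ = omega0 ^ log omega0 o * ((i + 1 : ℕ) : Ordinal) := by
      rw [Nat.cast_add_one, mul_add_one]
    _ ≤ omega0 ^ log omega0 o * (stdBlocks o : Ordinal) := by gcongr; exact hi
    _ ≤ o := by rw [natCast_stdBlocks]; exact mul_div_le o _

theorem SeqBounded.block {o : Ordinal.{0}} {f : Ordinal.{0} → ℝ} (hf : SeqBounded o f)
    {i : ℕ} (hi : i < stdBlocks o) :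
    SeqBounded (omega0 ^ log omega0 o)
      (fun ξ => f (omega0 ^ log omega0 o * (i : Ordinal) + ξ)) :=
  hf.imp fun _ hC _ hξ => hC _ (block_index_lt hi hξ)

theorem SeqBounded.mono {o o' : Ordinal.{0}} {f : Ordinal.{0} → ℝ} (hf : SeqBounded o f)
    (h : o' ≤ o) : SeqBounded o' f :=
  hf.imp fun _ hC _ hξ => hC _ (hξ.trans_le h)

theorem SeqBounded.const_mul {o : Ordinal.{0}} {f : Ordinal.{0} → ℝ} (hf : SeqBounded o f)
    (a : ℝ) : SeqBounded o (fun ξ => a * f ξ) := by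
  obtain ⟨C, hC⟩ := hf
  refine ⟨|a| * C, fun ξ hξ => ?_⟩
  rw [abs_mul]
  exact mul_le_mul_of_nonneg_left (hC ξ hξ) (abs_nonneg a)

theorem SeqBounded.add {o : Ordinal.{0}} {f g : Ordinal.{0} → ℝ} (hf : SeqBounded o f)
    (hg : SeqBounded o g) : SeqBounded o (fun ξ => f ξ + g ξ) := by
  obtain ⟨C, hC⟩ := hf
  obtain ⟨D, hD⟩ := hg
  exact ⟨C + D, fun ξ hξ => (abs_add_le _ _).trans (add_le_add (hC ξ hξ) (hD ξ hξ))⟩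

theorem opow_log_lt_of_ne {o : Ordinal.{0}} (ho : o ≠ 0) (h : o ≠ omega0 ^ log omega0 o) :
    omega0 ^ log omega0 o < o :=
  (opow_log_le_self _ ho).lt_of_ne h.symm

/-- Case distinction along the recursive definition of the upper mean. -/
theorem upperMean_cases (o : Ordinal.{0}) :
    o = 0 ∨ o = 1 ∨ (1 < o ∧ o = omega0 ^ log omega0 o) ∨
      (1 < o ∧ o ≠ omega0 ^ log omega0 o) := by
  rcases lt_trichotomy o 1 with h | h | h
  · exact Or.inl (Order.lt_one_iff.1 h)
  · exact Or.inr (Or.inl h)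
  · by_cases h' : o = omega0 ^ log omega0 o
    · exact Or.inr (Or.inr (Or.inl ⟨h, h'⟩))
    · exact Or.inr (Or.inr (Or.inr ⟨h, h'⟩))

theorem abs_upperMean_le {o : Ordinal.{0}} {f : Ordinal.{0} → ℝ} {C : ℝ} (hC : 0 ≤ C)
    (hf : ∀ ξ < o, |f ξ| ≤ C) : |upperMean o f| ≤ C := by
  induction o using WellFoundedLT.induction generalizing f with
  | ind o ih =>
    rcases upperMean_cases o with rfl | rfl | ⟨h, h'⟩ | ⟨h, h'⟩
    · simpa [upperMean_zero] using hC
    · simpa [upperMean_one] using hf 0 zero_lt_one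
    · have key : ∀ ξ < o, |upperMean ξ f| ≤ C := fun ξ hξ =>
        ih ξ hξ fun η hη => hf η (hη.trans hξ)
      have lower : ∀ ζ : Set.Ico (1 : Ordinal.{0}) o,
          -C ≤ ⨆ ξ : Set.Ico ζ.1 o, upperMean ξ.1 f := fun ζ =>
        le_ciSup_of_le
          ⟨C, by rintro _ ⟨ξ, rfl⟩; exact (abs_le.1 (key ξ.1 ξ.2.2)).2⟩
          ⟨ζ.1, le_rfl, ζ.2.2⟩ (abs_le.1 (key ζ.1 ζ.2.2)).1
      have : Nonempty (Set.Ico (1 : Ordinal.{0}) o) := ⟨⟨1, le_rfl, h⟩⟩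
      rw [upperMean_indecomposable h h']
      refine abs_le.2 ⟨le_ciInf lower, ?_⟩
      refine ciInf_le_of_le ⟨-C, by rintro _ ⟨ζ, rfl⟩; exact lower ζ⟩ ⟨1, le_rfl, h⟩ ?_
      exact Real.iSup_le (fun ξ => (abs_le.1 (key ξ.1 ξ.2.2)).2) hC
    · have ho : o ≠ 0 := (zero_lt_one.trans h).ne'
      rw [upperMean_decomposable h h', abs_mul, abs_inv, Nat.abs_cast]
      have hsum := (Finset.abs_sum_le_sum_abs _ _).trans
        (Finset.sum_le_card_nsmul (Finset.range (stdBlocks o)) _ C fun i hi =>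
          ih _ (opow_log_lt_of_ne ho h') fun ξ hξ =>
            hf _ (block_index_lt (Finset.mem_range.1 hi) hξ))
      rw [Finset.card_range, _root_.nsmul_eq_mul] at hsum
      exact inv_mul_le_of_le_mul₀ (Nat.cast_nonneg _) hC hsum

theorem SeqBounded.exists_abs_upperMean_le {o : Ordinal.{0}} {f : Ordinal.{0} → ℝ}
    (hf : SeqBounded o f) : ∃ C : ℝ, ∀ ξ ≤ o, |upperMean ξ f| ≤ C := by
  obtain ⟨C, hC⟩ := hf
  exact ⟨max C 0, fun ξ hξ => abs_upperMean_le (le_max_right _ _) fun η hη =>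
    (hC η (hη.trans_le hξ)).trans (le_max_left _ _)⟩

theorem SeqBounded.bddAbove_upperMean {o : Ordinal.{0}} {f : Ordinal.{0} → ℝ}
    (hf : SeqBounded o f) (ζ : Ordinal.{0}) :
    BddAbove (Set.range fun ξ : Set.Ico ζ o => upperMean ξ.1 f) := by
  obtain ⟨C, hC⟩ := hf.exists_abs_upperMean_le
  refine ⟨C, ?_⟩
  rintro _ ⟨ξ, rfl⟩
  exact (abs_le.1 (hC ξ.1 ξ.2.2.le)).2

theorem SeqBounded.bddBelow_iSup_upperMean {o : Ordinal.{0}} {f : Ordinal.{0} → ℝ}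
    (hf : SeqBounded o f) :
    BddBelow (Set.range fun ζ : Set.Ico (1 : Ordinal.{0}) o =>
      ⨆ ξ : Set.Ico ζ.1 o, upperMean ξ.1 f) := by
  obtain ⟨C, hC⟩ := hf.exists_abs_upperMean_le
  refine ⟨-C, ?_⟩
  rintro _ ⟨ζ, rfl⟩
  exact le_ciSup_of_le (hf.bddAbove_upperMean ζ.1) ⟨ζ.1, le_rfl, ζ.2.2⟩
    (abs_le.1 (hC ζ.1 ζ.2.2.le)).1

theorem upperMean_const_mul (o : Ordinal.{0}) (f : Ordinal.{0} → ℝ) {a : ℝ} (ha : 0 ≤ a) :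
    upperMean o (fun ξ => a * f ξ) = a * upperMean o f := by
  induction o using WellFoundedLT.induction generalizing f with
  | ind o ih =>
    rcases upperMean_cases o with rfl | rfl | ⟨h, h'⟩ | ⟨h, h'⟩
    · simp [upperMean_zero]
    · simp [upperMean_one]
    · simp_rw [upperMean_indecomposable h h', Real.mul_iInf_of_nonneg ha,
        Real.mul_iSup_of_nonneg ha]
      exact iInf_congr fun ζ => iSup_congr fun ξ => ih ξ.1 ξ.2.2 f
    · rw [upperMean_decomposable h h', upperMean_decomposable h h', mul_left_comm,
        Finset.mul_sum _ _ a]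
      congr 1
      exact Finset.sum_congr rfl fun i _ =>
        ih _ (opow_log_lt_of_ne (zero_lt_one.trans h).ne' h') _

theorem upperMean_add_le {o : Ordinal.{0}} {f g : Ordinal.{0} → ℝ} (hf : SeqBounded o f)
    (hg : SeqBounded o g) :
    upperMean o (fun ξ => f ξ + g ξ) ≤ upperMean o f + upperMean o g := by
  induction o using WellFoundedLT.induction generalizing f g with
  | ind o ih =>
    rcases upperMean_cases o with rfl | rfl | ⟨h, h'⟩ | ⟨h, h'⟩
    · simp [upperMean_zero]
    · simp [upperMean_one]
    · have : Nonempty (Set.Ico (1 : Ordinal.{0}) o) := ⟨⟨1, le_rfl, h⟩⟩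
      simp_rw [upperMean_indecomposable h h']
      refine le_ciInf_add_ciInf fun ζ₁ ζ₂ => ?_
      refine ciInf_le_of_le (hf.add hg).bddBelow_iSup_upperMean (max ζ₁ ζ₂) ?_
      have : Nonempty (Set.Ico (max ζ₁ ζ₂).1 o) := ⟨⟨_, le_rfl, (max ζ₁ ζ₂).2.2⟩⟩
      refine ciSup_le fun ξ => ?_
      refine (ih ξ.1 ξ.2.2 (hf.mono ξ.2.2.le) (hg.mono ξ.2.2.le)).trans (add_le_add ?_ ?_)
      · exact le_ciSup (hf.bddAbove_upperMean ζ₁.1)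
          ⟨ξ.1, le_trans (le_max_left ζ₁ ζ₂ : ζ₁.1 ≤ (max ζ₁ ζ₂).1) ξ.2.1, ξ.2.2⟩
      · exact le_ciSup (hg.bddAbove_upperMean ζ₂.1)
          ⟨ξ.1, le_trans (le_max_right ζ₁ ζ₂ : ζ₂.1 ≤ (max ζ₁ ζ₂).1) ξ.2.1, ξ.2.2⟩
    · have ho : o ≠ 0 := (zero_lt_one.trans h).ne'
      simp_rw [upperMean_decomposable h h', ← mul_add, ← Finset.sum_add_distrib]
      gcongr with i hi
      exact ih _ (opow_log_lt_of_ne ho h') (hf.block (Finset.mem_range.1 hi))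
        (hg.block (Finset.mem_range.1 hi))

theorem lowerMean_le_upperMean {o : Ordinal.{0}} {f : Ordinal.{0} → ℝ} (hf : SeqBounded o f) :
    lowerMean o f ≤ upperMean o f := by
  have hzero : upperMean o (fun _ => 0) = 0 := by
    simpa using upperMean_const_mul o f le_rfl
  have hadd := upperMean_add_le hf (hf.const_mul (-1))
  simp only [neg_one_mul, add_neg_cancel, hzero] at hadd
  rw [lowerMean]
  linarith

/-- A sequence having a mean is scaled by `a` of either sign compatibly with the upper mean. -/
theorem HasMean.upperMean_const_mul {o : Ordinal.{0}} {f : Ordinal.{0} → ℝ} {c : ℝ}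
    (h : HasMean o f c) (a : ℝ) : upperMean o (fun ξ => a * f ξ) = a * c := by
  rcases le_total 0 a with ha | ha
  · rw [_root_.upperMean_const_mul o f ha, h.1]
  · have key := _root_.upperMean_const_mul o (fun ξ => -f ξ) (neg_nonneg.2 ha)
    simp only [neg_mul_neg] at key
    rw [key, ← h.2, lowerMean, neg_mul, mul_neg]

/-- linearity of the mean.  If the means of the bounded sequences
`s` and `t` (of the same nonzero length `o`) exist, then for all reals `a, b` the
mean of the pointwise combination `a·s + b·t` exists and equals
`a·𝕄(s) + b·𝕄(t)`. -/
theorem hasMean_linear (o : Ordinal.{0}) (ho : o ≠ 0) (s t : Ordinal.{0} → ℝ)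
    (hs : SeqBounded o s) (ht : SeqBounded o t)
    (cs ct : ℝ) (hms : HasMean o s cs) (hmt : HasMean o t ct) (a b : ℝ) :
    HasMean o (fun ξ => a * s ξ + b * t ξ) (a * cs + b * ct) := by
  have upper : ∀ a b : ℝ, upperMean o (fun ξ => a * s ξ + b * t ξ) ≤ a * cs + b * ct :=
    fun a b => (upperMean_add_le (hs.const_mul a) (ht.const_mul b)).trans_eq
      (by rw [hms.upperMean_const_mul, hmt.upperMean_const_mul])
  have hneg := upper (-a) (-b)
  simp only [neg_mul, ← neg_add] at hneg
  have hlower : a * cs + b * ct ≤ lowerMean o (fun ξ => a * s ξ + b * t ξ) := le_neg.1 hneg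
  have hle := lowerMean_le_upperMean ((hs.const_mul a).add (ht.const_mul b))
  exact ⟨(upper a b).antisymm (hlower.trans hle), (hle.trans (upper a b)).antisymm hlower⟩
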